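/- Fix integers n ≥ 1 and α ≥ 1. The α-colored Eulerian polynomial A_n^α(X) = ∑_{π ∈ S_n} (αX)^{d(π)} (1 + (α−1)X)^{n−1−d(π)}, viewed as a polynomial with complex coefficients, has all of its roots real: every z ∈ ℂ with A_n^α(z) = 0 satisfies Im(z) = 0. -/

import Mathlib

def finLo {N : ℕ} (i : Fin (N - 1)) : Fin N := ⟨i.val, by have := i.isLt; omega⟩
def finHi {N : ℕ} (i : Fin (N - 1)) : Fin N := ⟨i.val + 1, by have := i.isLt; omega⟩

/-- The number of descents of a permutation of `Fin N`:
`d(π) = #{i : π(i) > π(i+1)}`. -/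
def descents {N : ℕ} (π : Equiv.Perm (Fin N)) : ℕ :=
  (Finset.univ.filter fun i : Fin (N - 1) => π (finHi i) < π (finLo i)).card

/-- Stirling numbers of the second kind. -/
def stirling : ℕ → ℕ → ℕ
  | 0, 0 => 1
  | 0, _ + 1 => 0
  | _ + 1, 0 => 0
  | n + 1, k + 1 => (k + 1) * stirling n (k + 1) + stirling n k

open Polynomial in
/-- If all complex roots of a polynomial are real, then so are those of its derivative. -/
theorem im_eq_zero_of_eval_derivative_eq_zero {P : ℂ[X]}
    (hP : ∀ w : ℂ, P.eval w = 0 → w.im = 0) (hP' : derivative P ≠ 0) {z : ℂ}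
    (hz : (derivative P).eval z = 0) : z.im = 0 := by
  have hdeg : 0 < P.degree := by
    by_contra h
    rw [eq_C_of_degree_le_zero (not_lt.mp h), derivative_C] at hP'
    exact hP' rfl
  have hsub : P.rootSet ℂ ⊆ (LinearMap.ker Complex.imLm : Set ℂ) := by
    intro w hw
    rw [mem_rootSet, coe_aeval_eq_eval] at hw
    exact hP w hw.2
  have hmem : z ∈ (derivative P).rootSet ℂ := by
    rw [mem_rootSet, coe_aeval_eq_eval]
    exact ⟨hP', hz⟩
  exact convexHull_min hsub (LinearMap.ker Complex.imLm).convex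
    (rootSet_derivative_subset_convexHull_rootSet hdeg hmem)

/-- The one-line word of a permutation, extended by zero to all natural numbers. -/
def permWord {n : ℕ} (π : Equiv.Perm (Fin n)) (i : ℕ) : ℕ :=
  if h : i < n then (π ⟨i, h⟩ : ℕ) else 0

theorem permWord_lt {n : ℕ} (π : Equiv.Perm (Fin n)) {i : ℕ} (h : i < n) : permWord π i < n := by
  simp [permWord, h]

theorem descents_eq_sum_permWord {n : ℕ} (π : Equiv.Perm (Fin n)) :
    descents π = ∑ i ∈ Finset.range (n - 1), if permWord π (i + 1) < permWord π i then 1 else 0 := by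
  rw [descents, Finset.card_filter, Finset.sum_range]
  refine Finset.sum_congr rfl fun i _ => ?_
  have h₁ : i.val + 1 < n := by have := i.isLt; omega
  have h₀ : i.val < n := by omega
  refine if_congr ?_ rfl rfl
  simp [permWord, h₁, h₀, finHi, finLo]

theorem descents_le {n : ℕ} (π : Equiv.Perm (Fin n)) : descents π ≤ n - 1 := by
  simpa [descents] using Finset.card_filter_le (Finset.univ : Finset (Fin (n - 1))) _

/-- Insert the new maximum at position `p` in the one-line word of a permutation. -/
def insertMax {n : ℕ} (p : Fin (n + 1)) (σ : Equiv.Perm (Fin n)) : Equiv.Perm (Fin (n + 1)) :=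
  ((finSuccEquiv' p).trans (Equiv.optionCongr σ)).trans (finSuccEquiv' (Fin.last n)).symm

@[simp]
theorem insertMax_self {n : ℕ} (p : Fin (n + 1)) (σ : Equiv.Perm (Fin n)) :
    insertMax p σ p = Fin.last n := by
  simp [insertMax]

@[simp]
theorem insertMax_succAbove {n : ℕ} (p : Fin (n + 1)) (σ : Equiv.Perm (Fin n)) (i : Fin n) :
    insertMax p σ (p.succAbove i) = (σ i).castSucc := by
  simp [insertMax]

theorem insertMax_bijective (n : ℕ) :
    Function.Bijective fun x : Fin (n + 1) × Equiv.Perm (Fin n) => insertMax x.1 x.2 := by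
  rw [Fintype.bijective_iff_injective_and_card]
  constructor
  · rintro ⟨p, σ⟩ ⟨q, τ⟩ h
    have h' : insertMax p σ = insertMax q τ := h
    have hpq : p = q := by
      apply (insertMax q τ).injective
      rw [insertMax_self, ← h', insertMax_self]
    subst hpq
    refine Prod.ext rfl (Equiv.ext fun i => Fin.castSucc_injective n ?_)
    rw [← insertMax_succAbove p, ← insertMax_succAbove p, h']
  · simp [Fintype.card_perm, Nat.factorial_succ]

theorem permWord_insertMax {n : ℕ} (p : Fin (n + 1)) (σ : Equiv.Perm (Fin n)) {i : ℕ}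
    (hi : i < n + 1) :
    permWord (insertMax p σ) i =
      if i < p then permWord σ i else if i = p then n else permWord σ (i - 1) := by
  rcases lt_trichotomy i p with h | h | h
  · have hin : i < n := by omega
    have : (⟨i, hi⟩ : Fin (n + 1)) = p.succAbove ⟨i, hin⟩ := by
      rw [Fin.succAbove_of_castSucc_lt _ _ (by simpa [Fin.lt_def] using h)]
      rfl
    simp [permWord, hi, hin, h, this]
  · have : (⟨i, hi⟩ : Fin (n + 1)) = p := Fin.ext h
    simp only [permWord, dif_pos hi, this, insertMax_self, Fin.val_last]
    simp [h]
  · have hin : i - 1 < n := by omega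
    have : (⟨i, hi⟩ : Fin (n + 1)) = p.succAbove ⟨i - 1, hin⟩ := by
      rw [Fin.succAbove_of_le_castSucc _ _ (by simp [Fin.le_def]; omega)]
      apply Fin.ext
      simp
      omega
    simp [permWord, hi, hin, h.not_gt, h.ne', this]

theorem descents_insertMax_last {n : ℕ} (σ : Equiv.Perm (Fin (n + 1))) :
    descents (insertMax (Fin.last (n + 1)) σ) = descents σ := by
  simp only [descents_eq_sum_permWord, Nat.add_sub_cancel, Finset.sum_range_succ]
  have hlast : ¬ permWord (insertMax (Fin.last (n + 1)) σ) (n + 1) <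
      permWord (insertMax (Fin.last (n + 1)) σ) n := by
    have := permWord_lt σ (Nat.lt_succ_self n)
    rw [permWord_insertMax _ _ (by omega), permWord_insertMax _ _ (by omega)]
    simp
    omega
  rw [if_neg hlast, add_zero]
  refine Finset.sum_congr rfl fun i hi => ?_
  have hi' := Finset.mem_range.mp hi
  have hw : ∀ j < n + 1, permWord (insertMax (Fin.last (n + 1)) σ) j = permWord σ j := by
    intro j hj
    rw [permWord_insertMax _ _ (by omega), Fin.val_last, if_pos hj]
  rw [hw i (by omega), hw (i + 1) (by omega)]

theorem descents_insertMax_zero {n : ℕ} (σ : Equiv.Perm (Fin (n + 1))) :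
    descents (insertMax 0 σ) = descents σ + 1 := by
  simp only [descents_eq_sum_permWord, Nat.add_sub_cancel, Finset.sum_range_succ']
  have hfirst : permWord (insertMax 0 σ) (0 + 1) < permWord (insertMax 0 σ) 0 := by
    have := permWord_lt σ (Nat.succ_pos n)
    rw [permWord_insertMax _ _ (by omega), permWord_insertMax _ _ (by omega)]
    simp
    omega
  rw [if_pos hfirst]
  congr 1
  refine Finset.sum_congr rfl fun i hi => ?_
  have hi' := Finset.mem_range.mp hi
  rw [permWord_insertMax _ _ (by omega), permWord_insertMax _ _ (by omega)]
  simp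

theorem descents_insertMax_succ_castSucc {n : ℕ} (σ : Equiv.Perm (Fin (n + 1))) (m : Fin n) :
    descents (insertMax m.castSucc.succ σ) =
      if σ m.succ < σ m.castSucc then descents σ else descents σ + 1 := by
  obtain ⟨m, hm⟩ := m
  obtain ⟨k, rfl⟩ : ∃ k, n = m + 1 + k := ⟨n - (m + 1), by omega⟩
  have hcond : (σ (Fin.succ ⟨m, hm⟩) < σ (Fin.castSucc ⟨m, hm⟩)) ↔
      permWord σ (m + 1) < permWord σ m := by
    have h₁ : m + 1 < m + 1 + k + 1 := by omega
    have h₀ : m < m + 1 + k + 1 := by omega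
    simp [permWord, h₁, h₀]
  have hval : ((Fin.succ (Fin.castSucc ⟨m, hm⟩) : Fin (m + 1 + k + 2)) : ℕ) = m + 1 := rfl
  generalize Fin.succ (Fin.castSucc ⟨m, hm⟩) = p at hval ⊢
  have hw : ∀ i < m + 1 + k + 2, permWord (insertMax p σ) i =
      if i < m + 1 then permWord σ i else if i = m + 1 then m + 1 + k + 1
        else permWord σ (i - 1) := by
    intro i hi
    rw [permWord_insertMax _ _ hi, hval]
  have hw_low : ∀ i < m + 1, permWord (insertMax p σ) i = permWord σ i := by
    intro i hi
    rw [hw i (by omega), if_pos hi]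
  have hw_high : ∀ i < m + 1 + k + 1, m + 1 ≤ i →
      permWord (insertMax p σ) (i + 1) = permWord σ i := by
    intro i hi hmi
    rw [hw (i + 1) (by omega), if_neg (by omega), if_neg (by omega), Nat.add_sub_cancel]
  have hlt₀ := permWord_lt σ (i := m) (by omega)
  have hlt₁ := permWord_lt σ (i := m + 1) (by omega)
  simp only [hcond, descents_eq_sum_permWord]
  rw [show m + 1 + k + 1 + 1 - 1 = m + 1 + 1 + k by omega,
    show m + 1 + k + 1 - 1 = m + 1 + k by omega]
  simp only [Finset.sum_range_add, Finset.sum_range_one, add_zero]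
  have hfirst : ∀ i ∈ Finset.range m,
      (if permWord (insertMax p σ) (i + 1) < permWord (insertMax p σ) i then 1 else 0) =
        if permWord σ (i + 1) < permWord σ i then 1 else 0 := by
    intro i hi
    have hi' := Finset.mem_range.mp hi
    rw [hw_low i (by omega), hw_low (i + 1) (by omega)]
  have hrest : ∀ i ∈ Finset.range k,
      (if permWord (insertMax p σ) (m + 1 + 1 + i + 1) <
          permWord (insertMax p σ) (m + 1 + 1 + i) then 1 else 0) =
        if permWord σ (m + 1 + i + 1) < permWord σ (m + 1 + i) then 1 else 0 := by
    intro i hi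
    have hi' := Finset.mem_range.mp hi
    rw [show m + 1 + 1 + i = m + 1 + i + 1 by omega, hw_high (m + 1 + i) (by omega) (by omega),
      hw_high (m + 1 + i + 1) (by omega) (by omega)]
  rw [Finset.sum_congr rfl hfirst, Finset.sum_congr rfl hrest]
  have hm₁ : permWord (insertMax p σ) (m + 1) = m + 1 + k + 1 := by
    rw [hw _ (by omega)]; simp
  rw [hw_low m (by omega), hm₁, hw_high (m + 1) (by omega) le_rfl,
    if_neg (by omega : ¬ m + 1 + k + 1 < permWord σ m), if_pos hlt₁]
  split_ifs <;> omega

/-- Inserting the new maximum preserves the number `d` of descents in `d + 1` positions and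
increases it by one in the others. -/
theorem sum_descents_insertMax {M : Type*} [AddCommMonoid M] {n : ℕ}
    (σ : Equiv.Perm (Fin (n + 1))) (g : ℕ → M) :
    ∑ p, g (descents (insertMax p σ)) =
      (descents σ + 1) • g (descents σ) + (n + 1 - descents σ) • g (descents σ + 1) := by
  have hd : descents σ = (Finset.univ.filter fun i : Fin n => σ i.succ < σ i.castSucc).card := rfl
  have hle : descents σ ≤ n := descents_le σ
  have hnot : (Finset.univ.filter fun i : Fin n => ¬ σ i.succ < σ i.castSucc).card =
      n - descents σ := by
    have := Finset.card_filter_add_card_filter_not (s := (Finset.univ : Finset (Fin n)))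
      (fun i : Fin n => σ i.succ < σ i.castSucc)
    rw [Finset.card_univ, Fintype.card_fin] at this
    omega
  rw [Fin.sum_univ_succ, Fin.sum_univ_castSucc, Fin.succ_last, descents_insertMax_last,
    descents_insertMax_zero]
  simp only [descents_insertMax_succ_castSucc, apply_ite g]
  rw [Finset.sum_ite, Finset.sum_const, Finset.sum_const, hnot, ← hd,
    show n + 1 - descents σ = n - descents σ + 1 by omega, succ_nsmul, succ_nsmul]
  abel

open Polynomial in
/-- The homogenized Eulerian polynomial `∑ π, a ^ d(π) * b ^ (n - d(π))` at `a = 1 + X`,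
`b = X`. -/
noncomputable def shiftedEulerian (n : ℕ) : ℂ[X] :=
  ∑ π : Equiv.Perm (Fin n), (1 + X) ^ descents π * X ^ (n - descents π)

open Polynomial in
theorem shiftedEulerian_succ_succ (n : ℕ) :
    shiftedEulerian (n + 2) = X * derivative ((1 + X) * shiftedEulerian (n + 1)) := by
  rw [shiftedEulerian, ← (insertMax_bijective (n + 1)).sum_comp, Fintype.sum_prod_type_right,
    shiftedEulerian, Finset.mul_sum, derivative_sum, Finset.mul_sum]
  refine Finset.sum_congr rfl fun σ _ => ?_
  have hle : descents σ ≤ n := descents_le σ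
  rw [sum_descents_insertMax σ fun d => (1 + X : ℂ[X]) ^ d * X ^ (n + 2 - d)]
  obtain ⟨k, hk⟩ : ∃ k, n = descents σ + k := ⟨n - descents σ, by omega⟩
  generalize descents σ = d at hk
  subst hk
  rw [show d + k + 1 - d = k + 1 by omega, show d + k + 2 - d = k + 2 by omega,
    show d + k + 2 - (d + 1) = k + 1 by omega, ← mul_assoc, ← pow_succ']
  simp only [derivative_mul, derivative_pow, derivative_one, derivative_X,
    nsmul_eq_mul, Nat.cast_add, Nat.cast_one, map_add, map_natCast, map_one, Nat.add_sub_cancel]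
  ring

theorem shiftedEulerian_ne_zero (n : ℕ) : shiftedEulerian n ≠ 0 := by
  intro h
  have h₁ : ((∑ π : Equiv.Perm (Fin n), 2 ^ descents π : ℕ) : ℂ) = 0 := by
    have := congrArg (Polynomial.eval 1) h
    simpa [shiftedEulerian, Polynomial.eval_finsetSum, one_add_one_eq_two] using this
  rw [Nat.cast_eq_zero] at h₁
  have := Finset.sum_pos (s := (Finset.univ : Finset (Equiv.Perm (Fin n))))
    (f := fun π => 2 ^ descents π) (fun _ _ => by positivity) Finset.univ_nonempty
  omega

theorem im_eq_zero_of_eval_shiftedEulerian_eq_zero (n : ℕ) {z : ℂ}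
    (hz : (shiftedEulerian (n + 1)).eval z = 0) : z.im = 0 := by
  induction n generalizing z with
  | zero =>
    have hd (π : Equiv.Perm (Fin 1)) : descents π = 0 := Nat.le_zero.mp (descents_le π)
    simp [shiftedEulerian, hd] at hz
    simp [hz]
  | succ n ih =>
    have hne := shiftedEulerian_ne_zero (n + 2)
    rw [shiftedEulerian_succ_succ] at hz hne
    rw [Polynomial.eval_mul, Polynomial.eval_X, mul_eq_zero] at hz
    rcases hz with rfl | hz
    · exact Complex.zero_im
    · refine im_eq_zero_of_eval_derivative_eq_zero (fun w hw => ?_) (right_ne_zero_of_mul hne) hz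
      rw [Polynomial.eval_mul, mul_eq_zero] at hw
      rcases hw with hw | hw
      · have hw' : w = -1 := by
          simp at hw
          linear_combination hw
        simp [hw']
      · exact ih hw

/-- The homogenized Eulerian polynomial only vanishes at `(a, b)` with `a = b` or with
`b / (a - b)` real. -/
theorem im_div_sub_eq_zero {n : ℕ} (hn : 1 ≤ n) {a b : ℂ} (hab : a - b ≠ 0)
    (h : ∑ π : Equiv.Perm (Fin n), a ^ descents π * b ^ (n - 1 - descents π) = 0) :
    (b / (a - b)).im = 0 := by
  obtain ⟨n, rfl⟩ : ∃ m, n = m + 1 := ⟨n - 1, by omega⟩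
  apply im_eq_zero_of_eval_shiftedEulerian_eq_zero n
  have hone : 1 + b / (a - b) = a / (a - b) := by field_simp; ring
  have key : (shiftedEulerian (n + 1)).eval (b / (a - b)) =
      b / (a - b) ^ (n + 1) *
        ∑ π : Equiv.Perm (Fin (n + 1)), a ^ descents π * b ^ (n + 1 - 1 - descents π) := by
    rw [shiftedEulerian, Polynomial.eval_finsetSum, Finset.mul_sum]
    refine Finset.sum_congr rfl fun π _ => ?_
    have hle : descents π ≤ n := descents_le π
    obtain ⟨k, hk⟩ : ∃ k, n = descents π + k := ⟨n - descents π, by omega⟩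
    generalize descents π = d at hk
    subst hk
    simp only [Polynomial.eval_mul, Polynomial.eval_pow, Polynomial.eval_add, Polynomial.eval_one,
      Polynomial.eval_X, hone]
    rw [show d + k + 1 - d = k + 1 by omega, show d + k + 1 - 1 - d = k by omega,
      div_pow, div_pow]
    field_simp
    ring
  rw [key, h, mul_zero]

/-- For `n ≥ 1` and `α ≥ 1`, the `α`-colored Eulerian polynomial
`A_n^α(X) = ∑_{π ∈ S_n} (αX)^{d(π)} (1+(α−1)X)^{n−1−d(π)}`, viewed over `ℂ`,
has only real roots: any complex zero has imaginary part `0`. -/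
theorem stmt12 (n A : ℕ) (hn : 1 ≤ n) (hA : 1 ≤ A) (z : ℂ)
    (hz : ∑ π : Equiv.Perm (Fin n),
        ((A : ℂ) * z) ^ descents π *
          (1 + ((A : ℂ) - 1) * z) ^ (n - 1 - descents π) = 0) :
    z.im = 0 := by
  by_cases hz₁ : z = 1
  · simp [hz₁]
  have hsub : (A : ℂ) * z - (1 + ((A : ℂ) - 1) * z) = z - 1 := by ring
  have hz₁' : z - 1 ≠ 0 := sub_ne_zero.mpr hz₁
  have him := im_div_sub_eq_zero hn (by rwa [hsub]) hz
  rw [hsub] at him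
  have hA₀ : (A : ℂ) ≠ 0 := by
    rw [Nat.cast_ne_zero]
    omega
  obtain ⟨y, hy⟩ : ∃ y : ℝ, (1 + ((A : ℂ) - 1) * z) / (z - 1) = y :=
    ⟨_, (Complex.conj_eq_iff_re.mp (Complex.conj_eq_iff_im.mpr him)).symm⟩
  rw [div_eq_iff hz₁'] at hy
  have hmul : z * ((y : ℂ) - (A - 1)) = 1 + y := by linear_combination -hy
  have hne : (y : ℂ) - (A - 1) ≠ 0 := by
    intro h₀
    rw [h₀, mul_zero] at hmul
    exact hA₀ (by linear_combination -h₀ - hmul)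
  have hreal : z = (((1 + y) / (y - (A - 1)) : ℝ) : ℂ) := by
    push_cast
    rw [eq_div_iff hne, hmul]
  rw [hreal, Complex.ofReal_im]
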